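/- Suppose κ satisfies Assumption 1. Let x̂^(0), x̂^(1), … be estimate tuples and f^(1), f^(2), … randomized policies with f^(i) ∈ 𝔓(x̂^(i−1)) for every i, and suppose the sequence (f^(i)) is strictly non-degenerate. If x̂^(i−1) converges componentwise in d to some x̂'_{k:N} ∈ S^(N−k+1), then: (a) there exist an infinite subset {i_l} of ℕ and a non-degenerate policy f_{k:N} such that the subsequence f^(i_l) converges to f_{k:N}; and (b) every non-degenerate policy f_{k:N} arising as the limit of a convergent subsequence of (f^(i)) belongs to 𝔓(x̂'_{k:N}). -/

import Mathlib

open MeasureTheory Filter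
open scoped ENNReal NNReal Topology

noncomputable section

/-- The state space `S = ℝ² × [0, 2π)`. -/
abbrev S : Type := {x : ℝ × ℝ × ℝ // x.2.2 ∈ Set.Ico (0 : ℝ) (2 * Real.pi)}

/-- The metric `d` on `S`. -/
noncomputable def dS (x y : S) : ℝ :=
  Real.sqrt ((x.1.1 - y.1.1) ^ 2 + (x.1.2.1 - y.1.2.1) ^ 2
    + 2 * (Real.cos x.1.2.2 - Real.cos y.1.2.2) ^ 2
    + 2 * (Real.sin x.1.2.2 - Real.sin y.1.2.2) ^ 2)

/-- The initial state `x₀ = (0,0,0)`. -/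
def origin : S := ⟨(0, 0, 0), ⟨le_rfl, by positivity⟩⟩

/-- `κ` is a Markov kernel on `S`. -/
def IsMarkov (κ : S → Measure S) : Prop :=
  (∀ x, IsProbabilityMeasure (κ x)) ∧
    ∀ A : Set S, MeasurableSet A → Measurable fun x => κ x A

/-- Continuity of a real-valued function with respect to the metric `dS`. -/
def DContinuous (g : S → ℝ) : Prop :=
  ∀ x : S, ∀ ε : ℝ, 0 < ε → ∃ δ : ℝ, 0 < δ ∧ ∀ y : S, dS x y < δ → |g y - g x| < ε

/-- Openness with respect to the metric `dS`. -/
def DOpen (O : Set S) : Prop :=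
  ∀ x ∈ O, ∃ δ : ℝ, 0 < δ ∧ ∀ y : S, dS x y < δ → y ∈ O

/-- Assumption 1 on the kernel `κ`. -/
def Assumption1 (κ : S → Measure S) : Prop :=
  (∀ A : Set S, MeasurableSet A → DContinuous fun x => (κ x A).toReal) ∧
    ∀ O : Set S, DOpen O → O.Nonempty → ∀ x : S, 0 < κ x O

/-- Auxiliary downward value recursion; the first argument is the number
`N + 1 - j` of remaining stages. -/
noncomputable def Jaux (κ : S → Measure S) (c' : ℕ → ℝ) (xhat : ℕ → S) :
    ℕ → ℕ → S → ℝ≥0∞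
  | 0, _, _ => 0
  | m + 1, j, x =>
      min (ENNReal.ofReal (dS x (xhat j) ^ 2) + ∫⁻ y, Jaux κ c' xhat m (j + 1) y ∂(κ x))
        (ENNReal.ofReal (c' j))

/-- The optimal cost-to-go `J*_j(x, x̂_{j:N})`. -/
noncomputable def JJ (κ : S → Measure S) (c' : ℕ → ℝ) (N : ℕ) (xhat : ℕ → S)
    (j : ℕ) (x : S) : ℝ≥0∞ :=
  Jaux κ c' xhat (N + 1 - j) j x

/-- `G_j(x, x̂_{j:N}) = ∫ J*_j(y, x̂_{j:N}) κ(x)(dy)`. -/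
noncomputable def Gj (κ : S → Measure S) (c' : ℕ → ℝ) (N : ℕ) (xhat : ℕ → S)
    (j : ℕ) (x : S) : ℝ≥0∞ :=
  ∫⁻ y, JJ κ c' N xhat j y ∂(κ x)

/-- `G(x̂_{k:N}) = G_k(x₀, x̂_{k:N})`. -/
noncomputable def Gtot (κ : S → Measure S) (c' : ℕ → ℝ) (k N : ℕ) (xhat : ℕ → S) : ℝ≥0∞ :=
  Gj κ c' N xhat k origin

/-- A randomized policy: a tuple of Borel measurable functions `f_j : S → [0,1]`. -/
def IsPolicy (k N : ℕ) (f : ℕ → S → ℝ≥0∞) : Prop :=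
  ∀ j, k ≤ j → j ≤ N → Measurable (f j) ∧ ∀ x, f j x ≤ 1

/-- Auxiliary cost-to-go recursion for a policy; first argument is `N + 1 - j`. -/
noncomputable def Vaux (κ : S → Measure S) (c' : ℕ → ℝ) (xhat : ℕ → S)
    (f : ℕ → S → ℝ≥0∞) : ℕ → ℕ → S → ℝ≥0∞
  | 0, _, _ => 0
  | m + 1, j, x =>
      f j x * (ENNReal.ofReal (dS x (xhat j) ^ 2) + ∫⁻ y, Vaux κ c' xhat f m (j + 1) y ∂(κ x))
        + (1 - f j x) * ENNReal.ofReal (c' j)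

/-- The cost-to-go `V_j` of a policy `f` with estimates `x̂`. -/
noncomputable def VV (κ : S → Measure S) (c' : ℕ → ℝ) (N : ℕ) (xhat : ℕ → S)
    (f : ℕ → S → ℝ≥0∞) (j : ℕ) (x : S) : ℝ≥0∞ :=
  Vaux κ c' xhat f (N + 1 - j) j x

/-- The total expected cost `C(f_{k:N}, x̂_{k:N})`. -/
noncomputable def Cost (κ : S → Measure S) (c' : ℕ → ℝ) (k N : ℕ) (xhat : ℕ → S)
    (f : ℕ → S → ℝ≥0∞) : ℝ≥0∞ :=
  ∫⁻ y, VV κ c' N xhat f k y ∂(κ origin)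

/-- `f ∈ 𝔓(x̂_{k:N})`: `f` minimizes the cost over all randomized policies. -/
def inP (κ : S → Measure S) (c' : ℕ → ℝ) (k N : ℕ) (xhat : ℕ → S)
    (f : ℕ → S → ℝ≥0∞) : Prop :=
  IsPolicy k N f ∧
    ∀ g : ℕ → S → ℝ≥0∞, IsPolicy k N g → Cost κ c' k N xhat f ≤ Cost κ c' k N xhat g

/-- `x̂ ∈ 𝔛(f_{k:N})`: the estimates minimize the cost for the policy `f`. -/
def inX (κ : S → Measure S) (c' : ℕ → ℝ) (k N : ℕ) (f : ℕ → S → ℝ≥0∞)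
    (xhat : ℕ → S) : Prop :=
  ∀ yhat : ℕ → S, Cost κ c' k N xhat f ≤ Cost κ c' k N yhat f

/-- Conditioning a measure on "no transmission" at stage `j`. -/
noncomputable def condMeas (f : ℕ → S → ℝ≥0∞) (j : ℕ) (μ : Measure S) : Measure S :=
  (∫⁻ x, f j x ∂μ)⁻¹ • μ.withDensity (f j)

/-- The predicted measures `μ_{j|j−1}`, by recursion on `j - k`. -/
noncomputable def mupredAux (κ : S → Measure S) (f : ℕ → S → ℝ≥0∞) (k : ℕ) :
    ℕ → Measure S
  | 0 => κ origin
  | n + 1 => (condMeas f (k + n) (mupredAux κ f k n)).bind κ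

/-- `μ_{j|j−1}`. -/
noncomputable def mupred (κ : S → Measure S) (f : ℕ → S → ℝ≥0∞) (k j : ℕ) : Measure S :=
  mupredAux κ f k (j - k)

/-- `q_j = ∫ f_j dμ_{j|j−1}`. -/
noncomputable def qq (κ : S → Measure S) (f : ℕ → S → ℝ≥0∞) (k j : ℕ) : ℝ≥0∞ :=
  ∫⁻ x, f j x ∂(mupred κ f k j)

/-- `μ_{j|j}`. -/
noncomputable def mucond (κ : S → Measure S) (f : ℕ → S → ℝ≥0∞) (k j : ℕ) : Measure S :=
  condMeas f j (mupred κ f k j)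

/-- Non-degeneracy of a policy. -/
def NonDeg (κ : S → Measure S) (f : ℕ → S → ℝ≥0∞) (k N : ℕ) : Prop :=
  ∀ j, k ≤ j → j ≤ N → 0 < qq κ f k j

/-- The closed "no transmission" region `D̄_j`. -/
noncomputable def Dbar (κ : S → Measure S) (c' : ℕ → ℝ) (N : ℕ) (xhat : ℕ → S)
    (j : ℕ) : Set S :=
  {x : S | ENNReal.ofReal (dS x (xhat j) ^ 2) + ∫⁻ y, JJ κ c' N xhat (j + 1) y ∂(κ x)
      ≤ ENNReal.ofReal (c' j)}

/-- The open "no transmission" region `Ḏ_j`. -/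
noncomputable def Dund (κ : S → Measure S) (c' : ℕ → ℝ) (N : ℕ) (xhat : ℕ → S)
    (j : ℕ) : Set S :=
  {x : S | ENNReal.ofReal (dS x (xhat j) ^ 2) + ∫⁻ y, JJ κ c' N xhat (j + 1) y ∂(κ x)
      < ENNReal.ofReal (c' j)}

/-- Hypothesis (H). -/
def HypH (κ : S → Measure S) (c' : ℕ → ℝ) (k N : ℕ) : Prop :=
  ∀ j, k ≤ j → j ≤ N → ∃ xhat : ℕ → S, (Dund κ c' N xhat j).Nonempty

/-- Weak convergence of measures on `(S, dS)`: tested against `dS`-continuous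
bounded functions. -/
def WeakConvS (μl : ℕ → Measure S) (μ : Measure S) : Prop :=
  ∀ h : S → ℝ, DContinuous h → (∃ C : ℝ, ∀ x, |h x| ≤ C) →
    Tendsto (fun l => ∫ x, h x ∂(μl l)) atTop (𝓝 (∫ x, h x ∂μ))

/-- Convergence of a sequence of (non-degenerate) policies to a policy. -/
def PolConv (κ : S → Measure S) (k N : ℕ) (g : ℕ → ℕ → S → ℝ≥0∞)
    (f : ℕ → S → ℝ≥0∞) : Prop :=
  ∀ j, k ≤ j → j ≤ N →
    WeakConvS (fun l => mucond κ (g l) k j) (mucond κ f k j) ∧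
      Tendsto (fun l => qq κ (g l) k j) atTop (𝓝 (qq κ f k j))

lemma seqcomp (lam : Measure S) [IsFiniteMeasure lam] (m : ℕ → Measure S)
    (hm : ∀ l, m l ≤ lam) :
    ∃ φ : ℕ → ℕ, StrictMono φ ∧ ∃ ν : Measure S, IsFiniteMeasure ν ∧
      ∀ g : S → ℝ, Measurable g → (∃ C, ∀ x, |g x| ≤ C) →
        Tendsto (fun l => ∫ x, g x ∂(m (φ l))) atTop (𝓝 (∫ x, g x ∂ν)) := by
  have hfin : ∀ l, IsFiniteMeasure (m l) := fun l => isFiniteMeasure_of_le lam (hm l)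
  have hb : ∀ l, ∀ᵐ x ∂lam, ‖((m l).rnDeriv lam x).toReal‖ ≤ 1 := by
    intro l
    filter_upwards [Measure.rnDeriv_le_one_of_le (hm l)] with x hx
    rw [Real.norm_of_nonneg ENNReal.toReal_nonneg]
    exact ENNReal.toReal_le_of_le_ofReal zero_le_one (by simpa using hx)
  have hmem : ∀ l, MemLp (fun x => ((m l).rnDeriv lam x).toReal) 2 lam := fun l =>
    MemLp.of_bound (Measure.measurable_rnDeriv _ _).ennreal_toReal.aestronglyMeasurable 1 (hb l)
  let U : ℕ → Lp ℝ 2 lam := fun l => (hmem l).toLp _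
  have hgm : ∀ g : S → ℝ, Measurable g → (∃ C, ∀ x, |g x| ≤ C) → MemLp g 2 lam := by
    rintro g hg ⟨C, hC⟩
    exact MemLp.of_bound hg.aestronglyMeasurable C (ae_of_all _ hC)
  have hin : ∀ l (g : S → ℝ) (hg : MemLp g 2 lam),
      inner ℝ (U l) (hg.toLp g) = ∫ x, g x ∂(m l) := by
    intro l g hg
    rw [L2.inner_def]
    have h2 : m l = lam.withDensity ((m l).rnDeriv lam) :=
      (Measure.withDensity_rnDeriv_eq _ _ (Measure.absolutelyContinuous_of_le (hm l))).symm
    conv_rhs => rw [h2]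
    rw [integral_withDensity_eq_integral_toReal_smul (Measure.measurable_rnDeriv _ _)
      (Measure.rnDeriv_lt_top _ _)]
    apply integral_congr_ae
    filter_upwards [(hmem l).coeFn_toLp, hg.coeFn_toLp] with x h1 h3
    simp only [U]
    rw [h1, h3]
    simp [mul_comm]
  obtain ⟨R, hR⟩ : ∃ R : ℝ, ∀ l, ‖U l‖ ≤ R := by
    refine ⟨_, fun l => Lp.norm_le_of_ae_bound (C := 1) zero_le_one ?_⟩
    filter_upwards [(hmem l).coeFn_toLp, hb l] with x h1 h3
    simp only [U]
    rw [h1]; exact h3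
  have : Fact ((2:ℝ≥0∞) ≠ ⊤) := ⟨by simp⟩
  have : TopologicalSpace.SeparableSpace (Lp ℝ 2 lam) := inferInstance
  have hsc := WeakDual.isSeqCompact_closedBall ℝ (Lp ℝ 2 lam) 0 R
  obtain ⟨T, -, φ, hφ, hT⟩ := @hsc
    (fun l => StrongDual.toWeakDual (InnerProductSpace.toDual ℝ (Lp ℝ 2 lam) (U l))) (by
      intro l
      simp only [Set.mem_preimage, Metric.mem_closedBall, dist_zero_right]
      refine le_trans (le_of_eq ?_) (hR l)
      exact (InnerProductSpace.toDual ℝ (Lp ℝ 2 lam)).norm_map (U l))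
  obtain ⟨W, hW⟩ := (InnerProductSpace.toDual ℝ (Lp ℝ 2 lam)).surjective (WeakDual.toStrongDual T)
  have hlim : ∀ (g : S → ℝ) (hg : MemLp g 2 lam),
      Tendsto (fun l => ∫ x, g x ∂(m (φ l))) atTop (𝓝 (∫ x, g x * W x ∂lam)) := by
    intro g hg
    have h1 := (WeakBilin.tendsto_iff_forall_eval_tendsto _
      (fun _ _ h => ContinuousLinearMap.coe_injective h)).1 hT (hg.toLp g)
    have h3 : T (hg.toLp g) = ∫ x, g x * W x ∂lam := by
      have : T (hg.toLp g) = inner ℝ W (hg.toLp g) := by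
        rw [← InnerProductSpace.toDual_apply_apply, hW]; rfl
      rw [this, L2.inner_def]
      apply integral_congr_ae
      filter_upwards [hg.coeFn_toLp] with x h3
      rw [h3]; simp [mul_comm]
    rw [← h3]
    refine Tendsto.congr (fun l => ?_) h1
    exact hin (φ l) g hg
  have hWi : Integrable W lam := (Lp.memLp W).integrable (by norm_num)
  have hW0 : 0 ≤ᵐ[lam] W := by
    apply ae_nonneg_of_forall_setIntegral_nonneg hWi
    intro s hs _
    have h1 := hlim (s.indicator 1) (hgm _ (measurable_one.indicator hs) ⟨1, fun x => by
      by_cases h : x ∈ s <;> simp [h]⟩)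
    have h2 : ∫ x, s.indicator 1 x * W x ∂lam = ∫ x in s, W x ∂lam := by
      rw [← integral_indicator hs]
      congr 1; ext x
      by_cases h : x ∈ s <;> simp [h]
    rw [← h2]
    refine ge_of_tendsto' h1 fun l => integral_nonneg fun x => ?_
    by_cases h : x ∈ s <;> simp [h]
  refine ⟨φ, hφ, lam.withDensity (fun x => ENNReal.ofReal (W x)), ?_, ?_⟩
  · exact isFiniteMeasure_withDensity_ofReal hWi.2
  · intro g hg hC
    rw [integral_withDensity_eq_integral_toReal_smul₀
      (Lp.aestronglyMeasurable W).aemeasurable.ennreal_ofReal (ae_of_all _ fun x => ENNReal.ofReal_lt_top)]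
    have := hlim g (hgm g hg hC)
    convert this using 2
    apply integral_congr_ae
    filter_upwards [hW0] with x hx
    simp [ENNReal.toReal_ofReal hx, mul_comm]

/-- embedding into Euclidean space -/
def emb (x : S) : EuclideanSpace ℝ (Fin 4) :=
  !₂[x.1.1, x.1.2.1, Real.sqrt 2 * Real.cos x.1.2.2, Real.sqrt 2 * Real.sin x.1.2.2]

lemma dS_eq (x y : S) : dS x y = dist (emb x) (emb y) := by
  rw [EuclideanSpace.dist_eq, dS]
  congr 1
  simp only [Fin.sum_univ_four, emb, Real.dist_eq, sq_abs]
  have h : Real.sqrt 2 ^ 2 = 2 := Real.sq_sqrt (by norm_num)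
  simp only [Matrix.cons_val]
  rw [← mul_sub, ← mul_sub, mul_pow, mul_pow, h]

lemma dS_nonneg (x y : S) : 0 ≤ dS x y := Real.sqrt_nonneg _

lemma dS_comm (x y : S) : dS x y = dS y x := by rw [dS_eq, dS_eq, dist_comm]

lemma dS_tri (x y z : S) : dS x z ≤ dS x y + dS y z := by
  simp only [dS_eq]; exact dist_triangle _ _ _

lemma dS_cont (y : S) : Continuous fun x => dS y x := by
  unfold dS; fun_prop

lemma dS_meas (y : S) : Measurable fun x => dS x y := by
  simp_rw [fun x => dS_comm x y]; exact (dS_cont y).measurable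

lemma DContinuous.meas {h : S → ℝ} (hh : DContinuous h) : Measurable h := by
  apply Continuous.measurable
  rw [continuous_iff_continuousAt]
  intro x
  rw [ContinuousAt, Metric.tendsto_nhds]
  intro e he
  obtain ⟨δ, hδ, H⟩ := hh x e he
  have h1 : ∀ᶠ y in 𝓝 x, dS x y < δ := by
    apply (dS_cont x).continuousAt.eventually_lt continuousAt_const
    simpa [dS] using hδ
  filter_upwards [h1] with y hy
  exact H y hy

lemma dcont_min (y : S) (M : ℕ) : DContinuous fun x => (min (dS x y) M) ^ 2 := by
  intro x e he
  refine ⟨e / (2 * M + 1), by positivity, fun z hz => ?_⟩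
  have h1 : |dS z y - dS x y| ≤ dS x z := by
    rw [abs_le]
    constructor
    · linarith [dS_tri x z y]
    · linarith [dS_tri z x y, dS_comm x z]
  have h2 : |min (dS z y) M - min (dS x y) M| ≤ dS x z :=
    (abs_min_sub_min_le_max _ _ _ _).trans (by
      rw [sub_self, abs_zero]; exact max_le h1 (dS_nonneg x z))
  have ha : 0 ≤ min (dS z y) M := le_min (dS_nonneg _ _) (by positivity)
  have hb : 0 ≤ min (dS x y) M := le_min (dS_nonneg _ _) (by positivity)
  have ha' : min (dS z y) M ≤ M := min_le_right _ _
  have hb' : min (dS x y) M ≤ M := min_le_right _ _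
  have hM : (0:ℝ) ≤ M := by positivity
  rw [sq_sub_sq, abs_mul, abs_of_nonneg (by positivity)]
  calc _ ≤ (2 * M : ℝ) * dS x z := by
        apply mul_le_mul (by linarith) h2 (abs_nonneg _) (by positivity)
    _ ≤ (2 * M + 1) * dS x z := by nlinarith [dS_nonneg x z]
    _ < e := by
      rw [lt_div_iff₀ (by positivity)] at hz
      linarith

lemma lsc_dist (y : S) (μl : ℕ → Measure S) (μ : Measure S)
    (hl : ∀ l, IsProbabilityMeasure (μl l)) (hμ : IsProbabilityMeasure μ)
    (h : WeakConvS μl μ) :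
    ∫⁻ x, ENNReal.ofReal (dS x y ^ 2) ∂μ ≤
      liminf (fun l => ∫⁻ x, ENNReal.ofReal (dS x y ^ 2) ∂(μl l)) atTop := by
  have hbd : ∀ (M : ℕ) (x : S), |min (dS x y) (M:ℝ) ^ 2| ≤ (M:ℝ) ^ 2 := by
    intro M x
    have ha : 0 ≤ min (dS x y) M := le_min (dS_nonneg _ _) (by positivity)
    rw [abs_of_nonneg (by positivity)]
    exact pow_le_pow_left₀ ha (min_le_right _ _) 2
  have hle : ∀ (M : ℕ) (x : S), min (dS x y) (M:ℝ) ^ 2 ≤ dS x y ^ 2 := by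
    intro M x
    have ha : 0 ≤ min (dS x y) M := le_min (dS_nonneg _ _) (by positivity)
    exact pow_le_pow_left₀ ha (min_le_left _ _) 2
  have hint : ∀ (ν : Measure S), IsProbabilityMeasure ν → ∀ M : ℕ,
      ∫⁻ x, ENNReal.ofReal (min (dS x y) (M:ℝ) ^ 2) ∂ν
        = ENNReal.ofReal (∫ x, min (dS x y) (M:ℝ) ^ 2 ∂ν) := by
    intro ν hν M
    rw [ofReal_integral_eq_lintegral_ofReal]
    · exact Integrable.of_bound (dcont_min y M).meas.aestronglyMeasurable _ (ae_of_all _ (hbd M))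
    · exact ae_of_all _ fun x => sq_nonneg _
  have hsup : ∀ x, ENNReal.ofReal (dS x y ^ 2) = ⨆ M : ℕ, ENNReal.ofReal (min (dS x y) (M:ℝ) ^ 2) := by
    intro x
    apply le_antisymm
    · obtain ⟨M, hM⟩ := exists_nat_ge (dS x y)
      refine le_iSup_of_le M ?_
      rw [min_eq_left hM]
    · exact iSup_le fun M => ENNReal.ofReal_le_ofReal (hle M x)
  simp_rw [fun x => hsup x]
  rw [lintegral_iSup (fun M => (dcont_min y M).meas.ennreal_ofReal) (by
    intro M M' hMM x
    apply ENNReal.ofReal_le_ofReal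
    have ha : 0 ≤ min (dS x y) M := le_min (dS_nonneg _ _) (by positivity)
    refine pow_le_pow_left₀ ha (min_le_min_left _ (by exact_mod_cast hMM)) 2)]
  refine iSup_le fun M => ?_
  have h1 := (ENNReal.continuous_ofReal.tendsto _).comp (h _ (dcont_min y M) ⟨_, hbd M⟩)
  rw [hint μ hμ, ← h1.liminf_eq]
  refine liminf_le_liminf (Eventually.of_forall fun l => ?_)
  simp only [Function.comp]
  rw [← hint _ (hl l)]
  exact lintegral_mono fun x => le_iSup (fun M : ℕ => ENNReal.ofReal (min (dS x y) (M:ℝ) ^ 2)) M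

lemma liminf_add_ge' (u v : ℕ → ℝ≥0∞) :
    liminf u atTop + liminf v atTop ≤ liminf (fun l => u l + v l) atTop := by
  simp only [liminf_eq_iSup_iInf_of_nat]
  rw [ENNReal.iSup_add_iSup_of_monotone]
  · refine iSup_mono fun n => ?_
    refine le_iInf₂ fun i hi => ?_
    exact add_le_add (iInf₂_le i hi) (iInf₂_le i hi)
  · intro a b hab
    exact biInf_mono fun i hi => le_trans hab hi
  · intro a b hab
    exact biInf_mono fun i hi => le_trans hab hi

lemma meas_kappa {κ : S → Measure S} (hκ : IsMarkov κ) : Measurable κ :=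
  Measure.measurable_of_measurable_coe _ hκ.2

lemma Vaux_meas {κ : S → Measure S} (hκ : IsMarkov κ) (c' : ℕ → ℝ) (xh : ℕ → S)
    {f : ℕ → S → ℝ≥0∞} {k N : ℕ} (hf : IsPolicy k N f) :
    ∀ m j, k ≤ j → j + m ≤ N + 1 → Measurable (Vaux κ c' xh f m j) := by
  intro m
  induction m with
  | zero => intro j _ _; exact measurable_const
  | succ m ih =>
    intro j hj hm
    have h1 := ih (j+1) (by omega) (by omega)
    have h2 := (hf j hj (by omega)).1
    have h3 : Measurable fun x => ∫⁻ y, Vaux κ c' xh f m (j + 1) y ∂(κ x) :=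
      (Measure.measurable_lintegral h1).comp (meas_kappa hκ)
    have h4 := dS_meas (xh j)
    change Measurable fun x => f j x * (ENNReal.ofReal (dS x (xh j) ^ 2) +
      ∫⁻ y, Vaux κ c' xh f m (j + 1) y ∂(κ x)) + (1 - f j x) * ENNReal.ofReal (c' j)
    fun_prop

lemma mupred_succ (κ : S → Measure S) (f : ℕ → S → ℝ≥0∞) {k j : ℕ} (hj : k ≤ j) :
    mupred κ f k (j + 1) = (mucond κ f k j).bind κ := by
  obtain ⟨n, rfl⟩ := Nat.exists_eq_add_of_le hj
  simp [mupred, mucond, mupredAux, show k + n + 1 - k = n + 1 by omega]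

lemma mupred_self (κ : S → Measure S) (f : ℕ → S → ℝ≥0∞) (k : ℕ) :
    mupred κ f k k = κ origin := by
  simp [mupred, mupredAux]

lemma bind_prob {κ : S → Measure S} (hκ : IsMarkov κ) (μ : Measure S) [IsProbabilityMeasure μ] :
    IsProbabilityMeasure (μ.bind κ) := by
  constructor
  rw [Measure.bind_apply MeasurableSet.univ (meas_kappa hκ).aemeasurable]
  have := hκ.1
  simp

lemma q_le_one (μ : Measure S) [IsProbabilityMeasure μ] (g : S → ℝ≥0∞) (hg : ∀ x, g x ≤ 1) :
    ∫⁻ x, g x ∂μ ≤ 1 := by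
  refine (lintegral_mono hg).trans ?_
  simp

lemma cond_prob (f : ℕ → S → ℝ≥0∞) (j : ℕ) (μ : Measure S) [IsProbabilityMeasure μ]
    (hg : ∀ x, f j x ≤ 1) (h0 : 0 < ∫⁻ x, f j x ∂μ) :
    IsProbabilityMeasure (condMeas f j μ) := by
  constructor
  simp only [condMeas, Measure.smul_apply, smul_eq_mul]
  rw [withDensity_apply _ MeasurableSet.univ, setLIntegral_univ]
  exact ENNReal.inv_mul_cancel h0.ne' ((q_le_one μ _ hg).trans_lt ENNReal.one_lt_top).ne

lemma prob {κ : S → Measure S} (hκ : IsMarkov κ) {f : ℕ → S → ℝ≥0∞} {k N : ℕ}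
    (hf : IsPolicy k N f) (hn : NonDeg κ f k N) :
    ∀ j, k ≤ j → j ≤ N →
      IsProbabilityMeasure (mupred κ f k j) ∧ IsProbabilityMeasure (mucond κ f k j) := by
  intro j hj
  induction j, hj using Nat.le_induction with
  | base =>
    intro hN
    have h1 : IsProbabilityMeasure (mupred κ f k k) := by
      rw [mupred_self]; exact hκ.1 _
    exact ⟨h1, cond_prob f k _ (hf k le_rfl hN).2 (hn k le_rfl hN)⟩
  | succ j hj ih =>
    intro hN
    have h1 : IsProbabilityMeasure (mupred κ f k (j+1)) := by
      rw [mupred_succ κ f hj]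
      have := (ih (by omega)).2
      exact bind_prob hκ _
    exact ⟨h1, cond_prob f _ _ (hf _ (by omega) hN).2 (hn _ (by omega) hN)⟩

lemma cost_step {κ : S → Measure S} (hκ : IsMarkov κ) (c' : ℕ → ℝ) (xh : ℕ → S)
    {f : ℕ → S → ℝ≥0∞} {k N : ℕ} (hf : IsPolicy k N f) (hn : NonDeg κ f k N)
    (m j : ℕ) (hj : k ≤ j) (hm : j + m = N) :
    ∫⁻ x, Vaux κ c' xh f (m+1) j x ∂(mupred κ f k j) =
      qq κ f k j * (∫⁻ x, ENNReal.ofReal (dS x (xh j) ^ 2) ∂(mucond κ f k j)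
        + ∫⁻ x, Vaux κ c' xh f m (j+1) x ∂(mupred κ f k (j+1)))
      + (1 - qq κ f k j) * ENNReal.ofReal (c' j) := by
  have hjN : j ≤ N := by omega
  obtain ⟨hp1, hp2⟩ := prob hκ hf hn j hj hjN
  have h2 := (hf j hj hjN).1
  have h1 := Vaux_meas hκ c' xh hf m (j+1) (by omega) (by omega)
  have h3 : Measurable fun x => ∫⁻ y, Vaux κ c' xh f m (j + 1) y ∂(κ x) :=
    (Measure.measurable_lintegral h1).comp (meas_kappa hκ)
  have h4 := dS_meas (xh j)
  have hq0 := (hn j hj hjN).ne'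
  have hq1 : qq κ f k j ≤ 1 := q_le_one _ _ (hf j hj hjN).2
  have hqt : qq κ f k j ≠ ⊤ := (hq1.trans_lt ENNReal.one_lt_top).ne
  rw [mupred_succ κ f hj, Measure.lintegral_bind (meas_kappa hκ).aemeasurable h1.aemeasurable]
  rw [← lintegral_add_right _ h3]
  simp only [mucond, condMeas]
  rw [lintegral_smul_measure, smul_eq_mul, ← mul_assoc]
  change _ = qq κ f k j * (qq κ f k j)⁻¹ * _ + _
  rw [ENNReal.mul_inv_cancel hq0 hqt, one_mul,
    lintegral_withDensity_eq_lintegral_mul _ h2 (by fun_prop)]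
  have h5 : (1 - qq κ f k j) = ∫⁻ x, (1 - f j x) ∂(mupred κ f k j) := by
    rw [lintegral_sub h2 hqt (ae_of_all _ (hf j hj hjN).2)]
    simp [qq]
  rw [h5, ← lintegral_mul_const _ (by fun_prop), ← lintegral_add_right _ (by fun_prop)]
  rfl

lemma lsc_cost {κ : S → Measure S} (hκ : IsMarkov κ) (c' : ℕ → ℝ) (xh : ℕ → S)
    {f : ℕ → S → ℝ≥0∞} {k N : ℕ} (hf : IsPolicy k N f) (hn : NonDeg κ f k N)
    (fl : ℕ → ℕ → S → ℝ≥0∞) (hfl : ∀ l, IsPolicy k N (fl l)) (hnl : ∀ l, NonDeg κ (fl l) k N)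
    (hc : PolConv κ k N fl f) :
    ∀ m j, k ≤ j → j + m = N + 1 →
      ∫⁻ x, Vaux κ c' xh f m j x ∂(mupred κ f k j) ≤
        liminf (fun l => ∫⁻ x, Vaux κ c' xh (fl l) m j x ∂(mupred κ (fl l) k j)) atTop := by
  intro m
  induction m with
  | zero => intro j _ _; simp [Vaux]
  | succ m ih =>
    intro j hj hm
    have h1 := ih (j+1) (by omega) (by omega)
    obtain ⟨hw, hq⟩ := hc j hj (by omega)
    rw [cost_step hκ c' xh hf hn m j hj (by omega)]
    simp_rw [fun l => cost_step hκ c' xh (hfl l) (hnl l) m j hj (by omega)]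
    have h2 := lsc_dist (xh j) _ _ (fun l => (prob hκ (hfl l) (hnl l) j hj (by omega)).2)
      (prob hκ hf hn j hj (by omega)).2 hw
    refine le_trans ?_ (liminf_add_ge' _ _)
    gcongr
    · refine le_trans ?_ (ENNReal.le_liminf_mul (u := fun l => qq κ (fl l) k j))
      rw [hq.liminf_eq]
      gcongr
      exact (add_le_add h2 h1).trans (liminf_add_ge' _ _)
    · refine (Tendsto.liminf_eq ?_).ge
      refine ENNReal.Tendsto.mul_const ?_ (Or.inr ENNReal.ofReal_ne_top)
      exact ENNReal.Tendsto.sub tendsto_const_nhds hq (Or.inl ENNReal.one_ne_top)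

lemma Cost_eq (κ : S → Measure S) (c' : ℕ → ℝ) (k N : ℕ) (xh : ℕ → S) (f : ℕ → S → ℝ≥0∞) :
    Cost κ c' k N xh f = ∫⁻ x, Vaux κ c' xh f (N + 1 - k) k x ∂(mupred κ f k k) := by
  rw [mupred_self]; rfl

lemma dist_pert (x y z : S) (δ : ℝ≥0) (h : dS y z ≤ δ) :
    ENNReal.ofReal (dS x y ^ 2) ≤ (1 + δ) * ENNReal.ofReal (dS x z ^ 2) + (δ + δ ^ 2) := by
  have h1 : dS x y ≤ dS x z + δ := (dS_tri x z y).trans (by rw [dS_comm z y]; linarith)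
  have h2 : dS x y ^ 2 ≤ (1 + δ) * dS x z ^ 2 + (δ + δ ^ 2) := by
    have := pow_le_pow_left₀ (dS_nonneg x y) h1 2
    have hd : (0:ℝ) ≤ δ := δ.2
    nlinarith [mul_nonneg hd (sq_nonneg (dS x z - 1))]
  refine (ENNReal.ofReal_le_ofReal h2).trans (le_of_eq ?_)
  have hd : (0:ℝ) ≤ δ := δ.2
  rw [ENNReal.ofReal_add (by positivity) (by positivity), ENNReal.ofReal_mul (by positivity),
    ENNReal.ofReal_add (by positivity) (by positivity),
    ENNReal.ofReal_add (by positivity) (by positivity), ENNReal.ofReal_pow hd]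
  simp

lemma Vaux_pert {κ : S → Measure S} (hκ : IsMarkov κ) (c' : ℕ → ℝ) (xh yh : ℕ → S)
    {f : ℕ → S → ℝ≥0∞} {k N : ℕ} (hf : IsPolicy k N f) (δ : ℝ≥0)
    (hd : ∀ j, k ≤ j → j ≤ N → dS (xh j) (yh j) ≤ δ) :
    ∀ m j, k ≤ j → j + m ≤ N + 1 → ∀ x,
      Vaux κ c' xh f m j x ≤ (1 + δ) * Vaux κ c' yh f m j x + m * (δ + δ ^ 2) := by
  intro m
  induction m with
  | zero => intro j _ _ x; simp [Vaux]
  | succ m ih =>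
    intro j hj hm x
    have := hκ.1
    have h1 : ∫⁻ y, Vaux κ c' xh f m (j+1) y ∂(κ x) ≤
        (1 + δ) * ∫⁻ y, Vaux κ c' yh f m (j+1) y ∂(κ x) + m * (δ + δ ^ 2) := by
      refine (lintegral_mono (ih (j+1) (by omega) (by omega))).trans (le_of_eq ?_)
      rw [lintegral_add_right _ measurable_const, lintegral_const_mul' _ _ (by finiteness)]
      simp
    have h2 := dist_pert x (xh j) (yh j) δ (hd j hj (by omega))
    have hf1 : f j x ≤ 1 := (hf j hj (by omega)).2 x
    simp only [Vaux]
    set a := f j x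
    set D := ENNReal.ofReal (dS x (yh j) ^ 2)
    set E := ∫⁻ y, Vaux κ c' yh f m (j+1) y ∂(κ x)
    set c := (1 - a) * ENNReal.ofReal (c' j)
    set e : ℝ≥0∞ := (δ + δ ^ 2 : ℝ≥0∞)
    set b : ℝ≥0∞ := 1 + δ
    calc _ ≤ a * ((b * D + e) + (b * E + m * e)) + 1 * c := by rw [one_mul]; gcongr
      _ = a * (b * (D + E)) + a * ((m + 1) * e) + 1 * c := by ring
      _ ≤ a * (b * (D + E)) + 1 * ((m + 1) * e) + b * c := by
        gcongr
        exact le_self_add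
      _ = _ := by push_cast; ring

lemma Cost_pert {κ : S → Measure S} (hκ : IsMarkov κ) (c' : ℕ → ℝ) (xh yh : ℕ → S)
    {f : ℕ → S → ℝ≥0∞} {k N : ℕ} (hf : IsPolicy k N f) (hkN : k ≤ N) (δ : ℝ≥0)
    (hd : ∀ j, k ≤ j → j ≤ N → dS (xh j) (yh j) ≤ δ) :
    Cost κ c' k N xh f ≤ (1 + δ) * Cost κ c' k N yh f + (N + 1 - k : ℕ) * (δ + δ ^ 2) := by
  have := hκ.1
  refine (lintegral_mono (Vaux_pert hκ c' xh yh hf δ hd (N+1-k) k le_rfl (by omega))).trans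
    (le_of_eq ?_)
  rw [lintegral_add_right _ measurable_const, lintegral_const_mul' _ _ (by finiteness)]
  simp only [lintegral_const, measure_univ, mul_one]
  rfl

lemma partB (κ : S → Measure S) (hκ : IsMarkov κ)
    (k N : ℕ) (hkN : k ≤ N) (c' : ℕ → ℝ)
    (xhat : ℕ → ℕ → S) (fseq : ℕ → ℕ → S → ℝ≥0∞)
    (hP : ∀ i, inP κ c' k N (xhat i) (fseq i))
    (hnd : ∀ i, NonDeg κ (fseq i) k N)
    (xhat' : ℕ → S)
    (hconv : ∀ j, k ≤ j → j ≤ N →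
      Tendsto (fun i => dS (xhat i j) (xhat' j)) atTop (𝓝 0))
    (f : ℕ → S → ℝ≥0∞) (hf : IsPolicy k N f) (hn : NonDeg κ f k N)
    (hc : PolConv κ k N fseq f) :
    inP κ c' k N xhat' f := by
  refine ⟨hf, fun g hg => ?_⟩
  have h1 : Cost κ c' k N xhat' f ≤ liminf (fun l => Cost κ c' k N xhat' (fseq l)) atTop := by
    simp_rw [Cost_eq]
    exact lsc_cost hκ c' xhat' hf hn fseq (fun l => (hP l).1) hnd hc _ _ le_rfl (by omega)
  by_cases hC : Cost κ c' k N xhat' g = ⊤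
  · rw [hC]; exact le_top
  lift Cost κ c' k N xhat' g to ℝ≥0 using hC with C hCe
  let δ : ℕ → ℝ≥0 := fun i => Real.toNNReal (∑ j ∈ Finset.Icc k N, dS (xhat i j) (xhat' j))
  have hδ : Tendsto δ atTop (𝓝 0) := by
    have : Tendsto (fun i => ∑ j ∈ Finset.Icc k N, dS (xhat i j) (xhat' j)) atTop
        (𝓝 (∑ j ∈ Finset.Icc k N, 0)) :=
      tendsto_finsetSum _ fun j hj => by
        rw [Finset.mem_Icc] at hj
        exact hconv j hj.1 hj.2
    rw [Finset.sum_const_zero] at this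
    have h5 := (continuous_real_toNNReal.tendsto 0).comp this
    rw [Real.toNNReal_zero] at h5
    exact h5
  have hdle : ∀ i j, k ≤ j → j ≤ N → dS (xhat i j) (xhat' j) ≤ δ i := by
    intro i j hj hjN
    refine le_trans ?_ (Real.le_coe_toNNReal _)
    exact Finset.single_le_sum (f := fun j => dS (xhat i j) (xhat' j))
      (fun j _ => dS_nonneg _ _) (Finset.mem_Icc.2 ⟨hj, hjN⟩)
  let n : ℝ≥0 := ((N + 1 - k : ℕ) : ℝ≥0)
  let F : ℝ≥0 → ℝ≥0 := fun d => (1 + d) * ((1 + d) * C + n * (d + d ^ 2)) + n * (d + d ^ 2)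
  have hF : Continuous F := by fun_prop
  have hF0 : F 0 = C := by simp [F]
  have h2 : ∀ i, Cost κ c' k N xhat' (fseq i) ≤ (F (δ i) : ℝ≥0∞) := by
    intro i
    refine (Cost_pert hκ c' xhat' (xhat i) (hP i).1 hkN (δ i) (fun j hj hjN => by
      rw [dS_comm]; exact hdle i j hj hjN)).trans ?_
    have h3 := ((hP i).2 g hg).trans (Cost_pert hκ c' (xhat i) xhat' hg hkN (δ i) (hdle i))
    rw [← hCe] at h3
    simp only [F, n]
    push_cast
    push_cast at h3
    gcongr
  have h4 : Tendsto (fun i => (F (δ i) : ℝ≥0∞)) atTop (𝓝 (C : ℝ≥0∞)) := by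
    rw [ENNReal.tendsto_coe, ← hF0]
    exact (hF.tendsto 0).comp hδ
  refine h1.trans ?_
  rw [← h4.liminf_eq]
  exact liminf_le_liminf (Eventually.of_forall h2)

/-- setwise-type convergence against bounded measurable functions -/
def SConv (m : ℕ → Measure S) (ν : Measure S) : Prop :=
  ∀ g : S → ℝ, Measurable g → (∃ C, ∀ x, |g x| ≤ C) →
    Tendsto (fun l => ∫ x, g x ∂(m l)) atTop (𝓝 (∫ x, g x ∂ν))

lemma SConv.lint {m : ℕ → Measure S} {ν : Measure S} (h : SConv m ν)
    (hm : ∀ l, IsFiniteMeasure (m l)) (hν : IsFiniteMeasure ν)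
    (g : S → ℝ≥0∞) (hg : Measurable g) (hg1 : ∀ x, g x ≤ 1) :
    Tendsto (fun l => ∫⁻ x, g x ∂(m l)) atTop (𝓝 (∫⁻ x, g x ∂ν)) := by
  have hfin : ∀ μ : Measure S, IsFiniteMeasure μ → ∫⁻ x, g x ∂μ ≠ ⊤ := by
    intro μ hμ
    refine ((lintegral_mono hg1).trans_lt ?_).ne
    simp
  have hlt : ∀ x, g x < ⊤ := fun x => (hg1 x).trans_lt ENNReal.one_lt_top
  have h1 := h (fun x => (g x).toReal) hg.ennreal_toReal ⟨1, fun x => by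
    rw [abs_of_nonneg ENNReal.toReal_nonneg]
    exact ENNReal.toReal_le_of_le_ofReal zero_le_one (by simpa using hg1 x)⟩
  rw [← ENNReal.tendsto_toReal_iff (fun l => hfin _ (hm l)) (hfin _ hν)]
  have h2 : ∀ μ : Measure S, ∫ x, (g x).toReal ∂μ = (∫⁻ x, g x ∂μ).toReal := fun μ =>
    integral_toReal hg.aemeasurable (ae_of_all _ hlt)
  simpa only [h2] using h1

/-- dominating measures -/
def Lam (κ : S → Measure S) (ε : ℝ≥0∞) : ℕ → Measure S
  | 0 => κ origin
  | n + 1 => (ε⁻¹ • Lam κ ε n).bind κ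

lemma bind_mono {κ : S → Measure S} (hκ : IsMarkov κ) {μ ν : Measure S} (h : μ ≤ ν) :
    μ.bind κ ≤ ν.bind κ := by
  rw [Measure.le_iff]
  intro s hs
  rw [Measure.bind_apply hs (meas_kappa hκ).aemeasurable,
    Measure.bind_apply hs (meas_kappa hκ).aemeasurable]
  exact lintegral_mono' h le_rfl

lemma Lam_fin {κ : S → Measure S} (hκ : IsMarkov κ) {ε : ℝ≥0∞} (hε : 0 < ε) (n : ℕ) :
    IsFiniteMeasure (Lam κ ε n) := by
  have := hκ.1
  induction n with
  | zero => exact inferInstanceAs (IsFiniteMeasure (κ origin))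
  | succ n ih =>
    constructor
    simp only [Lam]
    rw [Measure.bind_apply MeasurableSet.univ (meas_kappa hκ).aemeasurable]
    simp only [measure_univ, lintegral_const, one_mul, Measure.smul_apply, smul_eq_mul]
    exact ENNReal.mul_lt_top (ENNReal.inv_lt_top.2 hε) (measure_lt_top _ _)

lemma withDensity_le_self (μ : Measure S) (g : S → ℝ≥0∞) (hg : ∀ x, g x ≤ 1) :
    μ.withDensity g ≤ μ := by
  conv_rhs => rw [← withDensity_one (μ := μ)]
  exact withDensity_mono (ae_of_all _ hg)

lemma cond_le {κ : S → Measure S} {f : ℕ → S → ℝ≥0∞} {k N : ℕ}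
    (hf : IsPolicy k N f) {ε : ℝ≥0∞}
    (hq : ∀ j, k ≤ j → j ≤ N → ε ≤ qq κ f k j) (j : ℕ) (hj : k ≤ j) (hjN : j ≤ N) :
    mucond κ f k j ≤ ε⁻¹ • mupred κ f k j := by
  rw [Measure.le_iff]
  intro s hs
  simp only [mucond, condMeas, Measure.smul_apply, smul_eq_mul]
  have h1 := withDensity_le_self (mupred κ f k j) _ (hf j hj hjN).2 s
  have h2 : (∫⁻ x, f j x ∂(mupred κ f k j))⁻¹ ≤ ε⁻¹ := ENNReal.inv_le_inv.2 (hq j hj hjN)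
  exact mul_le_mul' h2 h1

lemma pred_le {κ : S → Measure S} (hκ : IsMarkov κ) {f : ℕ → S → ℝ≥0∞} {k N : ℕ}
    (hf : IsPolicy k N f) {ε : ℝ≥0∞}
    (hq : ∀ j, k ≤ j → j ≤ N → ε ≤ qq κ f k j) (n : ℕ) (hn : k + n ≤ N) :
    mupred κ f k (k + n) ≤ Lam κ ε n := by
  induction n with
  | zero => rw [add_zero, mupred_self]; exact le_rfl
  | succ n ih =>
    rw [← add_assoc, mupred_succ κ f (by omega)]
    apply bind_mono hκ
    refine (cond_le hf hq (k+n) (by omega) (by omega)).trans ?_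
    rw [Measure.le_iff]
    intro s _
    simp only [Measure.smul_apply, smul_eq_mul]
    gcongr
    exact ih (by omega)

lemma extract (κ : S → Measure S) (hκ : IsMarkov κ)
    (k N : ℕ) (fseq : ℕ → ℕ → S → ℝ≥0∞)
    (hP : ∀ i, IsPolicy k N (fseq i))
    (ε : ℝ≥0∞) (hε : 0 < ε)
    (hsnd : ∀ i j, k ≤ j → j ≤ N → ε ≤ qq κ (fseq i) k j) (n : ℕ) :
    ∃ φ : ℕ → ℕ, StrictMono φ ∧ ∀ i, i < n → k + i ≤ N →
      ∃ p : Measure S × ℝ≥0∞, IsFiniteMeasure p.1 ∧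
        SConv (fun l => mucond κ (fseq (φ l)) k (k+i)) p.1 ∧
        Tendsto (fun l => qq κ (fseq (φ l)) k (k+i)) atTop (𝓝 p.2) := by
  induction n with
  | zero => exact ⟨id, strictMono_id, fun i hi => absurd hi (by omega)⟩
  | succ n ih =>
    obtain ⟨φ, hφ, H⟩ := ih
    by_cases hn : k + n ≤ N
    · have hfin := Lam_fin hκ hε n
      have : IsFiniteMeasure (ε⁻¹ • Lam κ ε n) :=
        Measure.smul_finite _ (ENNReal.inv_ne_top.2 hε.ne')
      obtain ⟨ψ, hψ, ν, hν, hc⟩ := seqcomp (ε⁻¹ • Lam κ ε n)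
        (fun l => mucond κ (fseq (φ l)) k (k+n)) (fun l => by
          refine (cond_le (hP _) (hsnd _) (k+n) (by omega) hn).trans ?_
          rw [Measure.le_iff]
          intro s _
          simp only [Measure.smul_apply, smul_eq_mul]
          gcongr
          exact pred_le hκ (hP _) (hsnd _) n hn)
      obtain ⟨Q, χ, hχ, hQ⟩ := CompactSpace.tendsto_subseq
        (fun l => qq κ (fseq (φ (ψ l))) k (k+n))
      refine ⟨fun l => φ (ψ (χ l)), hφ.comp (hψ.comp hχ), fun i hi hiN => ?_⟩
      rcases Nat.lt_succ_iff_lt_or_eq.1 hi with h | rfl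
      · obtain ⟨p, hp1, hp2, hp3⟩ := H i h hiN
        have ht := (hψ.comp hχ).tendsto_atTop
        exact ⟨p, hp1, fun g hg hC => (hp2 g hg hC).comp ht, hp3.comp ht⟩
      · exact ⟨(ν, Q), hν, fun g hg hC => (hc g hg hC).comp hχ.tendsto_atTop, hQ⟩
    · refine ⟨φ, hφ, fun i hi hiN => H i (by omega) hiN⟩

/-- predicted limit measures -/
def Plim (κ : S → Measure S) (p : ℕ → Measure S × ℝ≥0∞) : ℕ → Measure S
  | 0 => κ origin
  | n + 1 => (p n).1.bind κ

lemma partA (κ : S → Measure S) (hκ : IsMarkov κ)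
    (k N : ℕ) (hkN : k ≤ N) (fseq : ℕ → ℕ → S → ℝ≥0∞)
    (hP : ∀ i, IsPolicy k N (fseq i))
    (ε : ℝ≥0∞) (hε : 0 < ε)
    (hsnd : ∀ i j, k ≤ j → j ≤ N → ε ≤ qq κ (fseq i) k j) :
    ∃ φ : ℕ → ℕ, StrictMono φ ∧
      ∃ f : ℕ → S → ℝ≥0∞, IsPolicy k N f ∧ NonDeg κ f k N ∧
        PolConv κ k N (fun l => fseq (φ l)) f := by
  have hnd : ∀ i, NonDeg κ (fseq i) k N := fun i j hj hjN => hε.trans_le (hsnd i j hj hjN)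
  obtain ⟨φ, hφ, H⟩ := extract κ hκ k N fseq hP ε hε hsnd (N + 1)
  replace H : ∀ i, ∃ p : Measure S × ℝ≥0∞, k + i ≤ N → IsFiniteMeasure p.1 ∧
        SConv (fun l => mucond κ (fseq (φ l)) k (k+i)) p.1 ∧
        Tendsto (fun l => qq κ (fseq (φ l)) k (k+i)) atTop (𝓝 p.2) := by
    intro i
    by_cases h : k + i ≤ N
    · obtain ⟨p, hp⟩ := H i (by omega) h
      exact ⟨p, fun _ => hp⟩
    · exact ⟨(0, 0), fun h' => absurd h' h⟩
  choose p hp using H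
  let P : ℕ → Measure S := Plim κ p
  let f : ℕ → S → ℝ≥0∞ := fun j x =>
    min 1 (((p (j-k)).2 • (p (j-k)).1).rnDeriv (P (j-k)) x)
  have hpr : ∀ l n, k + n ≤ N → IsProbabilityMeasure (mucond κ (fseq (φ l)) k (k+n)) :=
    fun l n hn => (prob hκ (hP _) (hnd _) (k+n) (by omega) hn).2
  have hprob : ∀ n, k + n ≤ N → IsProbabilityMeasure (p n).1 := by
    intro n hn
    obtain ⟨h1, h2, h3⟩ := hp n hn
    have h4 := h2.lint (fun l => by have := hpr l n hn; infer_instance) h1 (fun _ => 1)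
      measurable_const (fun _ => le_rfl)
    have h5 : ∀ l, mucond κ (fseq (φ l)) k (k+n) Set.univ = 1 := fun l => (hpr l n hn).measure_univ
    simp only [lintegral_const, one_mul, h5] at h4
    exact ⟨(tendsto_nhds_unique h4 tendsto_const_nhds)⟩
  have hq1 : ∀ l n, k + n ≤ N → qq κ (fseq (φ l)) k (k+n) ≤ 1 := by
    intro l n hn
    have := (prob hκ (hP (φ l)) (hnd _) (k+n) (by omega) hn).1
    exact q_le_one _ _ (hP _ _ (by omega) hn).2
  have hQ1 : ∀ n, k + n ≤ N → (p n).2 ≤ 1 := fun n hn =>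
    le_of_tendsto' (hp n hn).2.2 fun l => hq1 l n hn
  have hQe : ∀ n, k + n ≤ N → ε ≤ (p n).2 := fun n hn =>
    ge_of_tendsto' (hp n hn).2.2 fun l => hsnd _ _ (by omega) hn
  have hPP : ∀ n, k + n ≤ N → IsProbabilityMeasure (P n) := by
    intro n hn
    cases n with
    | zero => exact hκ.1 _
    | succ n =>
      have := hprob n (by omega)
      exact bind_prob hκ _
  have hPconv : ∀ n, k + n ≤ N → ∀ A, MeasurableSet A →
      Tendsto (fun l => mupred κ (fseq (φ l)) k (k+n) A) atTop (𝓝 (P n A)) := by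
    intro n hn A hA
    cases n with
    | zero => simp only [add_zero, mupred_self]; exact tendsto_const_nhds
    | succ n =>
      have hkm := (meas_kappa hκ)
      have h1 : ∀ l, mupred κ (fseq (φ l)) k (k+(n+1)) A =
          ∫⁻ x, κ x A ∂(mucond κ (fseq (φ l)) k (k+n)) := by
        intro l
        rw [← add_assoc, mupred_succ κ _ (by omega), Measure.bind_apply hA hkm.aemeasurable]
      have h2 : P (n+1) A = ∫⁻ x, κ x A ∂(p n).1 := Measure.bind_apply hA hkm.aemeasurable
      simp only [h1, h2]
      obtain ⟨h3, h4, h5⟩ := hp n (by omega)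
      have := hκ.1
      exact h4.lint (fun l => by have := hpr l n (by omega); infer_instance) h3 _ (hκ.2 A hA)
        (fun x => prob_le_one)
  have hle : ∀ n, k + n ≤ N → (p n).2 • (p n).1 ≤ P n := by
    intro n hn
    rw [Measure.le_iff]
    intro A hA
    obtain ⟨h3, h4, h5⟩ := hp n hn
    have h6 := h4.lint (fun l => by have := hpr l n hn; infer_instance) h3 (A.indicator 1)
      (measurable_one.indicator hA) (fun x => by by_cases h : x ∈ A <;> simp [h])
    simp only [lintegral_indicator_one hA] at h6
    have h7 := ENNReal.Tendsto.mul h5 (Or.inl (hε.trans_le (hQe n hn)).ne') h6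
      (Or.inr ((hQ1 n hn).trans_lt ENNReal.one_lt_top).ne)
    rw [Measure.smul_apply, smul_eq_mul]
    refine le_of_tendsto_of_tendsto' h7 (hPconv n hn A hA) fun l => ?_
    simp only [mucond, condMeas, Measure.smul_apply, smul_eq_mul]
    change qq κ (fseq (φ l)) k (k+n) * ((qq κ (fseq (φ l)) k (k+n))⁻¹ * _) ≤ _
    rw [← mul_assoc, ENNReal.mul_inv_cancel (hnd _ _ (by omega) hn).ne'
      ((hq1 l n hn).trans_lt ENNReal.one_lt_top).ne, one_mul]
    exact withDensity_le_self _ _ (hP _ _ (by omega) hn).2 A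
  have hfd : ∀ n, k + n ≤ N → (P n).withDensity (f (k+n)) = (p n).2 • (p n).1 := by
    intro n hn
    have i1 : IsProbabilityMeasure (P n) := hPP n hn
    have i2 : IsFiniteMeasure (P n) := ⟨by rw [i1.measure_univ]; exact ENNReal.one_lt_top⟩
    have i3 : IsFiniteMeasure ((p n).2 • (p n).1) := isFiniteMeasure_of_le (P n) (hle n hn)
    have h1 : f (k+n) =ᵐ[P n] ((p n).2 • (p n).1).rnDeriv (P n) := by
      filter_upwards [Measure.rnDeriv_le_one_of_le (hle n hn)] with x hx
      simp only [f, Nat.add_sub_cancel_left]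
      exact min_eq_right hx
    rw [withDensity_congr_ae h1]
    exact Measure.withDensity_rnDeriv_eq _ _ (Measure.absolutelyContinuous_of_le (hle n hn))
  have hint : ∀ n, k + n ≤ N → ∫⁻ x, f (k+n) x ∂(P n) = (p n).2 := by
    intro n hn
    have := hprob n hn
    have h1 := congrArg (fun μ : Measure S => μ Set.univ) (hfd n hn)
    simpa [withDensity_apply] using h1
  have hcond : ∀ n, k + n ≤ N → condMeas f (k+n) (P n) = (p n).1 := by
    intro n hn
    rw [condMeas, hint n hn, hfd n hn, smul_smul, ENNReal.inv_mul_cancel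
      (hε.trans_le (hQe n hn)).ne' ((hQ1 n hn).trans_lt ENNReal.one_lt_top).ne, one_smul]
  have hpred : ∀ n, k + n ≤ N → mupred κ f k (k+n) = P n := by
    intro n hn
    induction n with
    | zero => rw [add_zero, mupred_self]; rfl
    | succ n ih =>
      rw [← add_assoc, mupred_succ κ _ (by omega), mucond, ih (by omega), hcond n (by omega)]; rfl
  have hqq : ∀ n, k + n ≤ N → qq κ f k (k+n) = (p n).2 := by
    intro n hn
    rw [qq, hpred n hn, hint n hn]
  refine ⟨φ, hφ, f, ?_, ?_, ?_⟩
  · intro j _ _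
    exact ⟨measurable_const.min (Measure.measurable_rnDeriv _ _), fun x => min_le_left _ _⟩
  · intro j hj hjN
    obtain ⟨n, rfl⟩ := Nat.exists_eq_add_of_le hj
    rw [hqq n hjN]
    exact hε.trans_le (hQe n hjN)
  · intro j hj hjN
    obtain ⟨n, rfl⟩ := Nat.exists_eq_add_of_le hj
    rw [hqq n hjN, mucond, hpred n hjN, hcond n hjN]
    exact ⟨fun h hh hC => (hp n hjN).2.1 h hh.meas hC, (hp n hjN).2.2⟩

/-- Closedness of the best-response map `𝔓` along convergent estimate sequences:
(a) a strictly non-degenerate sequence of best-response policies has a convergent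
subsequence; (b) every non-degenerate limit of a convergent subsequence is a best
response to the limit estimates. (Here `fseq i` plays the role of `f^(i+1)` and
`xhat i` that of `x̂^(i)`, so `fseq i ∈ 𝔓(xhat i)`.) -/
theorem policies_closedness (κ : S → Measure S) (hκ : IsMarkov κ)
    (hA : Assumption1 κ)
    (k N : ℕ) (hkN : k ≤ N) (c' : ℕ → ℝ) (hc' : ∀ j, k ≤ j → j ≤ N → 0 < c' j)
    (xhat : ℕ → ℕ → S) (fseq : ℕ → ℕ → S → ℝ≥0∞)
    (hP : ∀ i, inP κ c' k N (xhat i) (fseq i))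
    (ε : ℝ≥0∞) (hε : 0 < ε)
    (hsnd : ∀ i j, k ≤ j → j ≤ N → ε ≤ qq κ (fseq i) k j)
    (xhat' : ℕ → S)
    (hconv : ∀ j, k ≤ j → j ≤ N →
      Tendsto (fun i => dS (xhat i j) (xhat' j)) atTop (𝓝 0)) :
    -- (a) there is a convergent subsequence with a non-degenerate limit policy
    (∃ φ : ℕ → ℕ, StrictMono φ ∧
      ∃ f : ℕ → S → ℝ≥0∞, IsPolicy k N f ∧ NonDeg κ f k N ∧
        PolConv κ k N (fun l => fseq (φ l)) f) ∧
    -- (b) every such limit belongs to `𝔓(x̂'_{k:N})`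
    (∀ (f : ℕ → S → ℝ≥0∞) (φ : ℕ → ℕ), StrictMono φ →
      IsPolicy k N f → NonDeg κ f k N →
      PolConv κ k N (fun l => fseq (φ l)) f →
      inP κ c' k N xhat' f) := by
  have hnd : ∀ i, NonDeg κ (fseq i) k N := fun i j hj hjN => hε.trans_le (hsnd i j hj hjN)
  refine ⟨partA κ hκ k N hkN fseq (fun i => (hP i).1) ε hε hsnd, ?_⟩
  intro f φ hφ hf hn hc
  exact partB κ hκ k N hkN c' (fun l => xhat (φ l)) (fun l => fseq (φ l)) (fun l => hP (φ l))
    (fun l => hnd (φ l)) xhat' (fun j hj hjN => (hconv j hj hjN).comp hφ.tendsto_atTop) f hf hn hc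

end
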